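/- Let X be a compact Hausdorff space such that the Sorgenfrey line is embeddable in X, i.e., some subset A ⊆ X with the subspace topology is homeomorphic to the Sorgenfrey line. Then X is not a continuous open image of the Sorgenfrey line; that is, there is no surjection from the Sorgenfrey line onto X that is continuous and an open map. -/

import Mathlib

open Set Filter Topology TopologicalSpace Function

noncomputable section

/-- The Sorgenfrey topology on `ℝ`: generated by half-open intervals `[a, b)`. -/
def sorgenfreyTop : TopologicalSpace ℝ :=
  TopologicalSpace.generateFrom {s : Set ℝ | ∃ a b : ℝ, s = Set.Ico a b}

/-- The initial segment `p↾n` of an infinite sequence, as a list. -/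
def restr (p : ℕ → ℕ) (n : ℕ) : List ℕ := (List.range n).map p

/-- `fruit V p = ⋂ n, V (p↾n)`. -/
def fruit {X : Type*} (V : List ℕ → Set X) (p : ℕ → ℕ) : Set X := ⋂ n, V (restr p n)

/-- A Souslin scheme is covering if `V ⟨⟩ = X` and `V a = ⋃ n, V (a ⌢ n)`. -/
def Covering {X : Type*} (V : List ℕ → Set X) : Prop :=
  V [] = Set.univ ∧ ∀ a : List ℕ, V a = ⋃ n : ℕ, V (a ++ [n])

/-- A Souslin scheme is complete if every fruit is nonempty. -/
def CompleteScheme {X : Type*} (V : List ℕ → Set X) : Prop :=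
  ∀ q : ℕ → ℕ, (fruit V q).Nonempty

/-- A Souslin scheme has strict branches if every fruit is a singleton. -/
def StrictBranches {X : Type*} (V : List ℕ → Set X) : Prop :=
  ∀ q : ℕ → ℕ, ∃ x : X, fruit V q = {x}

/-- A Souslin scheme is locally strict. -/
def LocallyStrict {X : Type*} (V : List ℕ → Set X) : Prop :=
  (∀ a : List ℕ, V a = ⋃ n : ℕ, V (a ++ [n])) ∧
  ∀ a : List ℕ, ∀ m k : ℕ, m ≠ k → V (a ++ [m]) ∩ V (a ++ [k]) = ∅

/-- `q ◁ p` for infinite sequences: `q↾n = p↾n` and `q n < p n` for some `n`. -/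
def tri (q p : ℕ → ℕ) : Prop := ∃ n : ℕ, restr q n = restr p n ∧ q n < p n

/-- `q ⊴ p` for infinite sequences. -/
def trieq (q p : ℕ → ℕ) : Prop := tri q p ∨ q = p

/-- `q ◁ s` where `q` is an infinite sequence and `s` a finite one. -/
def triL (q : ℕ → ℕ) (s : List ℕ) : Prop :=
  ∃ n : ℕ, ∃ h : n < s.length, restr q n = s.take n ∧ q n < s.get ⟨n, h⟩

/-- `rsequences(q, n) = {p | q ◁ p ∧ q↾n = p↾n}`. -/
def rsequences (q : ℕ → ℕ) (n : ℕ) : Set (ℕ → ℕ) :=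
  {p | tri q p ∧ restr q n = restr p n}

/-- `rsubtree(q, n)`: finite sequences `s` such that `q↾n ⊏ s` and `q ◁ s`. -/
def rsubtree (q : ℕ → ℕ) (n : ℕ) : Set (List ℕ) :=
  {s | restr q n <+: s ∧ restr q n ≠ s ∧ triL q s}

/-- `cut(V, q, n) = ⋃ {fruit(V, p) : p ∈ rsequences(q, n)}`. -/
def cut {X : Type*} (V : List ℕ → Set X) (q : ℕ → ℕ) (n : ℕ) : Set X :=
  ⋃ p ∈ rsequences q n, fruit V p

/-- `branches(V, x) = {q | x ∈ fruit(V, q)}`. -/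
def branches {X : Type*} (V : List ℕ → Set X) (x : X) : Set (ℕ → ℕ) :=
  {q | x ∈ fruit V q}

/-- `q` is a `τ`-base branch of `x` in `V`: `q ∈ branches(V, x)` and
`{cut(V, q, m) ∪ {x} : m ∈ ℕ}` is a neighborhood base of open sets at `x`. -/
def IsBaseBranch {X : Type*} (τ : TopologicalSpace X) (V : List ℕ → Set X)
    (q : ℕ → ℕ) (x : X) : Prop :=
  x ∈ fruit V q ∧ (∀ m : ℕ, IsOpen[τ] (cut V q m ∪ {x})) ∧
    (@nhds X τ x).HasBasis (fun _ : ℕ => True) (fun m : ℕ => cut V q m ∪ {x})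

/-- `BB(V, x, τ)`: the set of `τ`-base branches of `x` in `V`. -/
def BB {X : Type*} (τ : TopologicalSpace X) (V : List ℕ → Set X) (x : X) : Set (ℕ → ℕ) :=
  {q | IsBaseBranch τ V q x}

/-- A Sorgenfrey base for a space: an open complete covering Souslin scheme
satisfying (S1) and (S2). -/
def IsSorgenfreyBase {X : Type*} (τ : TopologicalSpace X) (V : List ℕ → Set X) : Prop :=
  (∀ a : List ℕ, IsOpen[τ] (V a)) ∧ CompleteScheme V ∧ Covering V ∧
  (∀ x : X, ∀ q ∈ branches V x, ∀ n : ℕ, ∃ t ∈ BB τ V x, restr t n = restr q n) ∧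
  (∀ q : ℕ → ℕ, ∃ z : X, q ∈ BB τ V z)

/-- The Souslin scheme `S` on the Baire set: `S a = {p | a ⊑ p}`. -/
def SchemeS (a : List ℕ) : Set (ℕ → ℕ) := {p | restr p a.length = a}

/-- The topology `σ_𝕊` on `ℕ → ℕ` generated by the base
`{cut(S, p, n) ∪ {p} : p ∈ ℕ → ℕ, n ∈ ℕ}`. -/
def sigmaS : TopologicalSpace (ℕ → ℕ) :=
  TopologicalSpace.generateFrom
    {U : Set (ℕ → ℕ) | ∃ p : ℕ → ℕ, ∃ n : ℕ, U = cut SchemeS p n ∪ {p}}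

/-- Every Sorgenfrey-open set contains a half-open interval to the right of each of its points. -/
theorem exists_Ico_subset_of_isOpen_sorgenfreyTop {U : Set ℝ} (hU : IsOpen[sorgenfreyTop] U) :
    ∀ x ∈ U, ∃ ε > 0, Ico x (x + ε) ⊆ U := by
  induction hU with
  | basic s hs =>
    obtain ⟨a, b, rfl⟩ := hs
    intro x hx
    exact ⟨b - x, by linarith [hx.2], fun z hz => ⟨hx.1.trans hz.1, by linarith [hz.2]⟩⟩
  | univ => exact fun x _ => ⟨1, one_pos, subset_univ _⟩
  | inter s t _ _ hs ht =>
    intro x hx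
    obtain ⟨ε, hε, h₁⟩ := hs x hx.1
    obtain ⟨δ, hδ, h₂⟩ := ht x hx.2
    refine ⟨min ε δ, lt_min hε hδ, fun z hz => ⟨h₁ ⟨hz.1, ?_⟩, h₂ ⟨hz.1, ?_⟩⟩⟩
    · linarith [hz.2, min_le_left ε δ]
    · linarith [hz.2, min_le_right ε δ]
  | sUnion T _ hT =>
    rintro x ⟨s, hs, hx⟩
    obtain ⟨ε, hε, h⟩ := hT s hs x hx
    exact ⟨ε, hε, h.trans (subset_sUnion_of_mem hs)⟩

theorem isOpen_sorgenfreyTop_Ico (a b : ℝ) : IsOpen[sorgenfreyTop] (Ico a b) :=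
  TopologicalSpace.isOpen_generateFrom_of_mem ⟨a, b, rfl⟩

/-- Baire category for Sorgenfrey-closed sets: if countably many sets cover a nonempty
Sorgenfrey-closed set `S`, one of them is dense in a nonempty relatively open part of `S`. -/
theorem exists_dense_of_sorgenfrey_closed {ι : Type*} [Countable ι] {S : Set ℝ}
    (hne : S.Nonempty) (hcl : ∀ β, (∀ ε > 0, ∃ s ∈ S, β ≤ s ∧ s < β + ε) → β ∈ S)
    (Q : ι → Set ℝ) (hQ : ∀ s ∈ S, ∃ i, s ∈ Q i) :
    ∃ i, ∃ a ∈ S, ∃ b, a < b ∧ ∀ c ∈ S, a ≤ c → c < b → ∀ d, c < d → ∃ q ∈ Q i, c ≤ q ∧ q < d := by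
  by_contra! H
  have hiso : ∀ p ∈ S, ∀ d, p < d → ∃ s ∈ S, p < s ∧ s < d := by
    intro p hp d hd
    by_contra! hs
    obtain ⟨i, hi⟩ := hQ p hp
    obtain ⟨c, hc, hpc, hcd, e, hce, hq⟩ := H i p hp d hd
    obtain rfl : p = c := by
      by_contra hne
      exact absurd hcd (hs c hc (lt_of_le_of_ne hpc hne)).not_gt
    exact absurd hce (hq p hi le_rfl).not_gt
  have step : ∀ i, ∀ a ∈ S, ∀ b, a < b →
      ∃ a' ∈ S, ∃ b' ∈ S, a ≤ a' ∧ a' < b' ∧ b' < b ∧ ∀ q ∈ Q i, a' ≤ q → b' ≤ q := by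
    intro i a ha b hab
    obtain ⟨c, hc, hac, hcb, d, hcd, hq⟩ := H i a ha b hab
    obtain ⟨s, hs, hcs, hsd⟩ := hiso c hc (min b d) (lt_min hcb hcd)
    exact ⟨c, hc, s, hs, hac, hcs, hsd.trans_le (min_le_left _ _),
      fun q hqi hcq => hsd.le.trans ((min_le_right _ _).trans (hq q hqi hcq))⟩
  obtain ⟨a₀, ha₀⟩ := hne
  obtain ⟨i₀, -⟩ := hQ a₀ ha₀
  have : Nonempty ι := ⟨i₀⟩
  obtain ⟨e, he⟩ := exists_surjective_nat ι
  obtain ⟨b₀, hb₀, hab₀, -⟩ := hiso a₀ ha₀ (a₀ + 1) (by linarith)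
  let T := {p : ℝ × ℝ // p.1 ∈ S ∧ p.2 ∈ S ∧ p.1 < p.2}
  have step' : ∀ (n : ℕ) (p : T), ∃ p' : T, p.1.1 ≤ p'.1.1 ∧ p'.1.2 < p.1.2 ∧
      ∀ q ∈ Q (e n), p'.1.1 ≤ q → p'.1.2 ≤ q := by
    rintro n ⟨⟨a, b⟩, ha, hb, hab⟩
    obtain ⟨a', ha', b', hb', h₁, h₂, h₃, h₄⟩ := step (e n) a ha b hab
    exact ⟨⟨(a', b'), ha', hb', h₂⟩, h₁, h₃, h₄⟩
  choose next hnext₁ hnext₂ hnext₃ using step'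
  let u : ℕ → T := fun n => Nat.rec ⟨(a₀, b₀), ha₀, hb₀, hab₀⟩ next n
  have hu : ∀ n, u (n + 1) = next n (u n) := fun n => rfl
  have hmono : Monotone fun n => (u n).1.1 :=
    monotone_nat_of_le_succ fun n => by rw [hu]; exact hnext₁ n (u n)
  have hanti : StrictAnti fun n => (u n).1.2 :=
    strictAnti_nat_of_succ_lt fun n => by rw [hu]; exact hnext₂ n (u n)
  have hle : ∀ m n, (u m).1.1 ≤ (u n).1.2 := fun m n =>
    (hmono (le_max_left m n)).trans
      ((u (max m n)).2.2.2.le.trans (hanti.antitone (le_max_right m n)))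
  have hbdd : BddBelow (range fun n => (u n).1.2) :=
    ⟨(u 0).1.1, by rintro _ ⟨n, rfl⟩; exact hle 0 n⟩
  set β := ⨅ n, (u n).1.2 with hβ
  have hβle : ∀ n, β ≤ (u n).1.2 := fun n => ciInf_le hbdd n
  have hβS : β ∈ S := by
    refine hcl β fun ε hε => ?_
    obtain ⟨n, hn⟩ := exists_lt_of_ciInf_lt (show (⨅ n, (u n).1.2) < β + ε by linarith)
    exact ⟨_, (u n).2.2.1, hβle n, hn⟩
  obtain ⟨i, hi⟩ := hQ β hβS
  obtain ⟨n, rfl⟩ := he i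
  have h₁ := hnext₃ n (u n) β hi (by rw [← hu]; exact le_ciInf (hle (n + 1)))
  rw [← hu] at h₁
  exact absurd ((hβle (n + 2)).trans_lt (hanti (Nat.lt_succ_self (n + 1)))) h₁.not_gt

section SorgenfreyEmbedding

variable {X : Type*} [TopologicalSpace X] {f g : ℝ → X}

/-- A left cluster point of a Sorgenfrey embedding is not in its range. -/
theorem notMem_range_of_mapClusterPt_left
    (hge : ∀ x, ∀ δ > 0, ∃ U ∈ 𝓝 (g x), ∀ z, g z ∈ U → z ∈ Ico x (x + δ))
    {y : X} {x : ℝ} (h : MapClusterPt y (𝓝[<] x) g) : y ∉ range g := by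
  rintro ⟨w, rfl⟩
  obtain ⟨δ, hδ, hwx⟩ : ∃ δ > 0, w < x → w + δ < x := by
    by_cases hw : w < x
    · exact ⟨(x - w) / 2, by linarith, fun _ => by linarith⟩
    · exact ⟨1, one_pos, fun h => absurd h hw⟩
  obtain ⟨U, hU, hUz⟩ := hge w δ hδ
  by_cases hw : w < x
  · obtain ⟨z, hz, hz'⟩ := ((mapClusterPt_iff_frequently.1 h U hU).and_eventually
      (Ioo_mem_nhdsLT (hwx hw))).exists
    linarith [(hUz z hz).2, hz'.1]
  · obtain ⟨z, hz, hz'⟩ := ((mapClusterPt_iff_frequently.1 h U hU).and_eventually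
      self_mem_nhdsWithin).exists
    have : z < x := hz'
    linarith [(hUz z hz).1]

/-- Points near a left cluster point are values of `g` arbitrarily close to `x` on the left. -/
theorem exists_lt_of_mapClusterPt_left {y : X} {x : ℝ} (h : MapClusterPt y (𝓝[<] x) g)
    {U : Set X} (hU : U ∈ 𝓝 y) {c : ℝ} (hc : c < x) : ∃ z, c < z ∧ z < x ∧ g z ∈ U := by
  obtain ⟨z, hz, hz'⟩ := ((mapClusterPt_iff_frequently.1 h U hU).and_eventually
    (Ioo_mem_nhdsLT hc)).exists
  exact ⟨z, hz'.1, hz'.2, hz⟩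

/-- A limit point of `g '' [0, 1)` outside that set is a left cluster point of `g`. -/
theorem exists_mapClusterPt_left [T2Space X]
    (hgc : ∀ x, ∀ U ∈ 𝓝 (g x), ∃ ε > 0, ∀ z ∈ Ico x (x + ε), g z ∈ U)
    {y : X} (hy : y ∈ closure (g '' Ico 0 1)) (hy' : y ∉ g '' Ico 0 1) :
    ∃ x, MapClusterPt y (𝓝[<] x) g := by
  have hne : (comap g (𝓝 y) ⊓ 𝓟 (Ico 0 1)).NeBot := by
    rw [← map_neBot_iff g, Filter.push_pull', map_principal]
    exact mem_closure_iff_clusterPt.1 hy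
  obtain ⟨x, hx, hcl⟩ := isCompact_Icc.exists_clusterPt
    (f := comap g (𝓝 y) ⊓ 𝓟 (Ico 0 1)) (inf_le_right.trans (principal_mono.2 Ico_subset_Icc_self))
  have hz : ∀ U ∈ 𝓝 y, ∀ V ∈ 𝓝 x, ∃ z ∈ V, g z ∈ U ∧ z ∈ Ico 0 1 := by
    intro U hU V hV
    obtain ⟨z, hzV, hz⟩ := clusterPt_iff_nonempty.1 hcl hV
      (inter_mem_inf (preimage_mem_comap hU) (mem_principal_self _))
    exact ⟨z, hzV, hz⟩
  have hleft : ∃ U ∈ 𝓝 y, ∃ ε > 0, ∀ z ∈ Ico 0 1, g z ∈ U → z < x + ε → z < x := by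
    rcases hx.2.eq_or_lt with rfl | hx1
    · exact ⟨univ, univ_mem, 1, one_pos, fun z hz _ _ => hz.2⟩
    · have hyx : g x ≠ y := fun h => hy' ⟨x, ⟨hx.1, hx1⟩, h⟩
      obtain ⟨W, U, hW, hU, hWU⟩ := t2_separation_nhds hyx
      obtain ⟨ε, hε, hg⟩ := hgc x W hW
      exact ⟨U, hU, ε, hε, fun z _ hzU hzx => not_le.1 fun hxz =>
        disjoint_left.1 hWU (hg z ⟨hxz, hzx⟩) hzU⟩
  obtain ⟨U₀, hU₀, ε, hε, hlt⟩ := hleft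
  refine ⟨x, mapClusterPt_iff_frequently.2 fun U hU => frequently_iff.2 fun {V} hV => ?_⟩
  obtain ⟨V', hV', hVV⟩ := mem_nhdsWithin_iff_exists_mem_nhds_inter.1 hV
  obtain ⟨z, hzV, hzU, hzI⟩ := hz (U ∩ U₀) (inter_mem hU hU₀) (V' ∩ Iio (x + ε))
    (inter_mem hV' (Iio_mem_nhds (by linarith)))
  exact ⟨z, hVV ⟨hzV.1, hlt z hzI hzU.2 hzV.2⟩, hzU.1⟩

/-- A compact Hausdorff space containing a Sorgenfrey line `g` admits no continuous open
surjection `f` from the Sorgenfrey line (both properties expressed through half-open intervals). -/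
theorem false_of_sorgenfrey_open_surjection [T2Space X] [CompactSpace X]
    (hgc : ∀ x, ∀ U ∈ 𝓝 (g x), ∃ ε > 0, ∀ z ∈ Ico x (x + ε), g z ∈ U)
    (hge : ∀ x, ∀ δ > 0, ∃ U ∈ 𝓝 (g x), ∀ z, g z ∈ U → z ∈ Ico x (x + δ))
    (hfc : ∀ t, ∀ U ∈ 𝓝 (f t), ∃ ε > 0, ∀ u ∈ Ico t (t + ε), f u ∈ U)
    (hfo : ∀ a b, ∀ u ∈ Ico a b, f '' Ico a b ∈ 𝓝 (f u))
    (hsurj : Surjective f) : False := by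
  let F := closure (g '' Ico 0 1)
  let r : ℕ → ℝ := fun n => 1 / ((n : ℝ) + 1)
  have hr : ∀ n, 0 < r n := fun n => Nat.one_div_pos_of_nat
  let P : ℕ → Set ℝ := fun n => {t | ∃ x ∈ Ico (0 : ℝ) 1, f t = g x ∧
    ∀ u ∈ Ico t (t + r n), ∀ z, f u = g z → x ≤ z}
  let M : ℕ → Set ℝ := fun n => {t | ∃ x, MapClusterPt (f t) (𝓝[<] x) g ∧
    ∀ u ∈ Ico t (t + r n), ∀ z ∈ Ico x (x + r n), f u ≠ g z}
  have hcover : ∀ t ∈ f ⁻¹' F, ∃ i, t ∈ Sum.elim P M i := by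
    intro t ht
    by_cases hA : f t ∈ g '' Ico 0 1
    · obtain ⟨x, hx, hxt⟩ := hA
      obtain ⟨U, hU, hUz⟩ := hge x 1 one_pos
      obtain ⟨ε, hε, hf⟩ := hfc t U (hxt ▸ hU)
      obtain ⟨n, hn⟩ := exists_nat_one_div_lt hε
      refine ⟨Sum.inl n, x, hx, hxt.symm, fun u hu z huz => (hUz z ?_).1⟩
      exact huz ▸ hf u ⟨hu.1, hu.2.trans (by simpa [r] using hn)⟩
    · obtain ⟨x, hx⟩ := exists_mapClusterPt_left hgc ht hA
      have hne : f t ≠ g x := fun h => notMem_range_of_mapClusterPt_left hge hx ⟨x, h.symm⟩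
      obtain ⟨U, V, hU, hV, hUV⟩ := t2_separation_nhds hne
      obtain ⟨ε, hε, hf⟩ := hfc t U hU
      obtain ⟨δ, hδ, hg⟩ := hgc x V hV
      obtain ⟨n, hn⟩ := exists_nat_one_div_lt (lt_min hε hδ)
      have hn : r n < min ε δ := hn
      refine ⟨Sum.inr n, x, hx, fun u hu z hz h => disjoint_left.1 hUV (hf u ⟨hu.1, ?_⟩)
        (h ▸ hg z ⟨hz.1, ?_⟩)⟩
      · linarith [hu.2, min_le_left ε δ]
      · linarith [hz.2, min_le_right ε δ]
  have hclosed : ∀ β, (∀ ε > 0, ∃ s ∈ f ⁻¹' F, β ≤ s ∧ s < β + ε) → β ∈ f ⁻¹' F := by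
    intro β hβ
    by_contra hn
    obtain ⟨ε, hε, hf⟩ := hfc β Fᶜ (isClosed_closure.isOpen_compl.mem_nhds hn)
    obtain ⟨s, hs, h₁, h₂⟩ := hβ ε hε
    exact hf s ⟨h₁, h₂⟩ hs
  have hne : (f ⁻¹' F).Nonempty := by
    obtain ⟨t, ht⟩ := hsurj (g 0)
    exact ⟨t, show f t ∈ F from ht ▸ subset_closure ⟨0, by simp, rfl⟩⟩
  obtain ⟨i, a, ha, b, hab, hdense⟩ :=
    exists_dense_of_sorgenfrey_closed hne hclosed (Sum.elim P M) hcover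
  rcases i with n | n
  · -- `P n` is dense near `a`, so `g⁻¹ ∘ f` is monotone there
    have hdense : ∀ c ∈ f ⁻¹' F, a ≤ c → c < b → ∀ d, c < d → ∃ q ∈ P n, c ≤ q ∧ q < d := hdense
    obtain ⟨q, ⟨x, hx, hqx, -⟩, haq, hqb⟩ := hdense a ha le_rfl hab b hab
    obtain ⟨N, hN, hNc, hNf⟩ := exists_mem_nhds_isClosed_subset (hfo q b q ⟨le_rfl, hqb⟩)
    obtain ⟨δ, hδ, hg⟩ := hgc x N (hqx ▸ hN)
    obtain ⟨x', hxx', hx'⟩ := exists_between (lt_min hx.2 (show x < x + δ by linarith))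
    have hev : ∀ᶠ z in 𝓝[<] x', g z ∈ N ∩ F := by
      filter_upwards [Ioo_mem_nhdsLT hxx'] with z hz
      exact ⟨hg z ⟨hz.1.le, by linarith [hz.2, min_le_right 1 (x + δ)]⟩, subset_closure
        ⟨z, ⟨hx.1.trans hz.1.le, by linarith [hz.2, min_le_left 1 (x + δ)]⟩, rfl⟩⟩
    obtain ⟨y, hy, hyc⟩ := (hNc.inter isClosed_closure).isCompact.exists_mapClusterPt
      (f := 𝓝[<] x') (u := g) (le_principal_iff.2 (mem_map.2 hev))
    obtain ⟨s, hs, rfl⟩ := hNf hy.1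
    have hrange := notMem_range_of_mapClusterPt_left hge hyc
    have hnear : ∀ d, s < d → ∃ q x, s < q ∧ q < d ∧ f q = g x ∧ 0 ≤ x ∧
        ∀ u ∈ Ico q (q + r n), ∀ z, f u = g z → x ≤ z := by
      intro d hd
      obtain ⟨q, ⟨x, hx, hqx, hq⟩, hsq, hqd⟩ := hdense s hy.2 (haq.trans hs.1) hs.2 d hd
      refine ⟨q, x, lt_of_le_of_ne hsq ?_, hqd, hqx, hx.1, hq⟩
      rintro rfl
      exact hrange ⟨x, hqx.symm⟩
    let W := {x : ℝ | 0 ≤ x ∧ ∃ q, s < q ∧ q < s + r n ∧ f q = g x}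
    have hWb : BddBelow W := ⟨0, fun x hx => hx.1⟩
    have hWne : W.Nonempty := by
      obtain ⟨q, x, h₁, h₂, h₃, h₄, -⟩ := hnear (s + r n) (by linarith [hr n])
      exact ⟨x, h₄, q, h₁, h₂, h₃⟩
    obtain ⟨U, V, hU, hV, hUV⟩ :=
      t2_separation_nhds (show f s ≠ g (sInf W) from fun h => hrange ⟨_, h.symm⟩)
    obtain ⟨ε, hε, hf⟩ := hfc s U hU
    obtain ⟨δ', hδ', hg'⟩ := hgc (sInf W) V hV
    obtain ⟨w, ⟨hw0, q₁, hsq₁, hq₁, hfq₁⟩, hw⟩ :=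
      exists_lt_of_csInf_lt hWne (show sInf W < sInf W + δ' by linarith)
    obtain ⟨q₂, x₂, hsq₂, hq₂, hfq₂, hx₂, hmin⟩ :=
      hnear (min q₁ (s + ε)) (lt_min hsq₁ (by linarith))
    have hq₂₁ : q₂ < q₁ := hq₂.trans_le (min_le_left _ _)
    have hle : x₂ ≤ w := hmin q₁ ⟨hq₂₁.le, by linarith⟩ w hfq₁
    refine disjoint_left.1 hUV (hf q₂ ⟨hsq₂.le, hq₂.trans_le (min_le_right _ _)⟩) ?_
    rw [hfq₂]
    exact hg' x₂ ⟨csInf_le hWb ⟨hx₂, q₂, hsq₂, hq₂₁.trans hq₁, hfq₂⟩, by linarith⟩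
  · -- `M n` is dense near `a`, so the associated left cluster positions are antitone there
    have hdense : ∀ c ∈ f ⁻¹' F, a ≤ c → c < b → ∀ d, c < d → ∃ q ∈ M n, c ≤ q ∧ q < d := hdense
    obtain ⟨_, ⟨s, hs, rfl⟩, x₀, hx₀, hsx₀⟩ :=
      mem_closure_iff_nhds.1 ha _ (hfo a b a ⟨le_rfl, hab⟩)
    have hsF : s ∈ f ⁻¹' F := show f s ∈ F from hsx₀ ▸ subset_closure ⟨x₀, hx₀, rfl⟩
    have hnear : ∀ δ > 0, ∀ d, s < d → ∃ q x, s < q ∧ q < d ∧ MapClusterPt (f q) (𝓝[<] x) g ∧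
        x₀ < x ∧ x ≤ x₀ + δ ∧ ∀ u ∈ Ico q (q + r n), ∀ z ∈ Ico x (x + r n), f u ≠ g z := by
      intro δ hδ d hd
      obtain ⟨U, hU, hUz⟩ := hge x₀ δ hδ
      obtain ⟨ε, hε, hf⟩ := hfc s U (hsx₀ ▸ hU)
      obtain ⟨q, ⟨x, hqx, hq⟩, hsq, hqd⟩ := hdense s hsF hs.1 hs.2 (min d (s + ε))
        (lt_min hd (by linarith))
      have hmem : f '' Ico s (s + ε) ∈ 𝓝 (f q) :=
        hfo _ _ q ⟨hsq, hqd.trans_le (min_le_right _ _)⟩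
      have hz : ∀ c < x, ∃ z, c < z ∧ z < x ∧ x₀ ≤ z ∧ z < x₀ + δ := by
        intro c hc
        obtain ⟨z, h₁, h₂, u, hu, huz⟩ := exists_lt_of_mapClusterPt_left hqx hmem hc
        exact ⟨z, h₁, h₂, hUz z (huz ▸ hf u hu)⟩
      refine ⟨q, x, lt_of_le_of_ne hsq ?_, hqd.trans_le (min_le_left _ _), hqx, ?_, ?_, hq⟩
      · rintro rfl
        exact notMem_range_of_mapClusterPt_left hge hqx ⟨x₀, hsx₀⟩
      · obtain ⟨z, -, h₁, h₂, -⟩ := hz (x - 1) (by linarith)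
        linarith
      · refine le_of_forall_lt fun c hc => ?_
        obtain ⟨z, h₁, -, -, h₂⟩ := hz c hc
        exact h₁.trans h₂
    obtain ⟨q, x, hsq, hqd, hqx, hx₀x, hxle, -⟩ := hnear (r n) (hr n) (s + r n) (by linarith [hr n])
    obtain ⟨q', x', hsq', hqd', -, hx₀x', hxle', hq'⟩ := hnear ((x - x₀) / 2) (by linarith) q hsq
    obtain ⟨z, hz₁, hz₂, u, hu, huz⟩ := exists_lt_of_mapClusterPt_left hqx
      (hfo q' (q' + r n) q ⟨hqd'.le, by linarith⟩) (show x' < x by linarith)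
    exact hq' u hu z ⟨hz₁.le, by linarith⟩ huz

end SorgenfreyEmbedding

/-- If the Sorgenfrey line embeds in a compact Hausdorff space `X`, then `X` is
not a continuous open image of the Sorgenfrey line. -/
theorem stmt18 {X : Type*} (τ : TopologicalSpace X) (hT2 : @T2Space X τ)
    (hc : @CompactSpace X τ) (A : Set X)
    (h : Nonempty (@Homeomorph ↥A ℝ (TopologicalSpace.induced Subtype.val τ) sorgenfreyTop)) :
    ¬ ∃ f : ℝ → X, @Continuous ℝ X sorgenfreyTop τ f ∧
      @IsOpenMap ℝ X sorgenfreyTop τ f ∧ Function.Surjective f := by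
  rintro ⟨f, hfc, hfo, hsurj⟩
  obtain ⟨e, he, hes⟩ := h
  have hcont : @Continuous ℝ X sorgenfreyTop τ fun x => (e.symm x : X) :=
    @Continuous.comp _ _ _ sorgenfreyTop _ _ _ _ continuous_subtype_val hes
  have hright : ∀ k : ℝ → X, @Continuous ℝ X sorgenfreyTop τ k →
      ∀ t, ∀ U ∈ 𝓝 (k t), ∃ ε > 0, ∀ u ∈ Ico t (t + ε), k u ∈ U := by
    intro k hk t U hU
    obtain ⟨V, hVU, hV, htV⟩ := mem_nhds_iff.1 hU
    obtain ⟨ε, hε, h⟩ :=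
      exists_Ico_subset_of_isOpen_sorgenfreyTop (@IsOpen.preimage _ _ sorgenfreyTop τ _ hk _ hV) t htV
    exact ⟨ε, hε, fun u hu => hVU (h hu)⟩
  refine false_of_sorgenfrey_open_surjection (g := fun x => (e.symm x : X)) (hright _ hcont) ?_
    (hright f hfc) (fun a b u hu =>
      (hfo _ (isOpen_sorgenfreyTop_Ico a b)).mem_nhds ⟨u, hu, rfl⟩) hsurj
  intro x δ hδ
  have hopen : IsOpen (e ⁻¹' Ico x (x + δ)) :=
    @IsOpen.preimage _ _ _ sorgenfreyTop _ he _ (isOpen_sorgenfreyTop_Ico x (x + δ))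
  obtain ⟨V, hV, hVe⟩ := isOpen_induced_iff.1 hopen
  have key : ∀ z, (e.symm z : X) ∈ V ↔ z ∈ Ico x (x + δ) := by
    intro z
    have : e.symm z ∈ Subtype.val ⁻¹' V ↔ e.symm z ∈ e ⁻¹' Ico x (x + δ) := by rw [hVe]
    simpa only [mem_preimage, e.apply_symm_apply] using this
  exact ⟨V, hV.mem_nhds ((key x).2 ⟨le_rfl, by linarith⟩), fun z => (key z).1⟩
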